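/- arXiv:2002.10078 — 6 statements merged into one kernel-verified Lean document; each statement's English description precedes it below -/
import Mathlib

section
/- Let n, m be positive integers and let x_1,…,x_m ∈ ℝⁿ each have every coordinate in {−1,0,1} with exactly three nonzero coordinates. Let w ∈ ℝⁿ have every coordinate in {−1,1}. Then (1/m)·Σ_{i=1}^m |wᵀx_i + 1| < 2/m if and only if wᵀx_i = −1 for every i = 1,…,m. -/
/-- A sum of signs over `s` has the same parity as `s.card`. -/
theorem exists_sum_eq_card_add_two_mul {ι : Type*} (s : Finset ι) (f : ι → ℝ)
    (hf : ∀ j ∈ s, f j = -1 ∨ f j = 1) : ∃ k : ℤ, ∑ j ∈ s, f j = s.card + 2 * k := by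
  classical
  induction s using Finset.induction_on with
  | empty => exact ⟨0, by simp⟩
  | insert a s ha ih =>
    obtain ⟨k, hk⟩ := ih fun j hj => hf j (Finset.mem_insert_of_mem hj)
    rw [Finset.sum_insert ha, Finset.card_insert_of_notMem ha, hk]
    rcases hf a (Finset.mem_insert_self a s) with h | h
    · exact ⟨k - 1, by rw [h]; push_cast; ring⟩
    · exact ⟨k, by rw [h]; push_cast; ring⟩

/-- The pairing of a sign vector with a vector of `{-1,0,1}ⁿ` with three nonzero coordinates
is an odd integer. -/
theorem exists_sum_mul_add_one_eq_two_mul {ι : Type*} [Fintype ι] (x w : ι → ℝ)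
    (hx : ∀ j, x j = -1 ∨ x j = 0 ∨ x j = 1)
    (hx3 : (Finset.univ.filter fun j => x j ≠ 0).card = 3)
    (hw : ∀ j, w j = -1 ∨ w j = 1) : ∃ k : ℤ, (∑ j, w j * x j) + 1 = 2 * k := by
  obtain ⟨k, hk⟩ := exists_sum_eq_card_add_two_mul
    (Finset.univ.filter fun j => x j ≠ 0) (fun j => w j * x j) (by
      intro j hj
      have h0 : x j ≠ 0 := by simpa using hj
      rcases hw j with h | h <;> rcases hx j with h' | h' | h' <;> simp_all)
  have hsum : ∑ j ∈ Finset.univ.filter (fun j => x j ≠ 0), w j * x j = ∑ j, w j * x j :=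
    Finset.sum_filter_of_ne fun j _ h => right_ne_zero_of_mul h
  refine ⟨k + 2, ?_⟩
  rw [← hsum, hk, hx3]
  push_cast
  ring

/-- For clause vectors `x i ∈ {-1,0,1}ⁿ`, each with exactly three nonzero
coordinates, and a sign vector `w ∈ {-1,1}ⁿ`, the average absolute-value loss
`(1/m) ∑ i |wᵀxᵢ + 1|` is below `2/m` iff `wᵀxᵢ = -1` for every `i`. -/
theorem avg_abs_loss_lt_iff (n m : ℕ) (hn : 0 < n) (hm : 0 < m)
    (x : Fin m → Fin n → ℝ)
    (hx : ∀ i : Fin m, ∀ j : Fin n, x i j = -1 ∨ x i j = 0 ∨ x i j = 1)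
    (hx3 : ∀ i : Fin m, (Finset.univ.filter fun j : Fin n => x i j ≠ 0).card = 3)
    (w : Fin n → ℝ) (hw : ∀ j : Fin n, w j = -1 ∨ w j = 1) :
    (1 / m : ℝ) * ∑ i, |(∑ j, w j * x i j) + 1| < 2 / m ↔
      ∀ i : Fin m, (∑ j, w j * x i j) = -1 := by
  have hm0 : (0 : ℝ) < m := by exact_mod_cast hm
  rw [one_div_mul_eq_div, div_lt_div_iff_of_pos_right hm0]
  constructor
  · intro h i
    obtain ⟨k, hk⟩ := exists_sum_mul_add_one_eq_two_mul (x i) w (hx i) (hx3 i) hw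
    have hi : |(∑ j, w j * x i j) + 1| < 2 :=
      (Finset.single_le_sum (f := fun i => |(∑ j, w j * x i j) + 1|)
        (fun _ _ => abs_nonneg _) (Finset.mem_univ i)).trans_lt h
    rw [hk, abs_lt] at hi
    have h1 : (-1 : ℝ) < k := by linarith [hi.1]
    have h2 : (k : ℝ) < 1 := by linarith [hi.2]
    have hk0 : k = 0 := by
      have h3 : -1 < k := by exact_mod_cast h1
      have h4 : k < 1 := by exact_mod_cast h2
      omega
    rw [hk0, Int.cast_zero, mul_zero] at hk
    linarith
  · intro h
    simp [h]
end

section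
/- Let n, m be positive integers and let x_1,…,x_m ∈ ℝⁿ each have every coordinate in {−1,0,1} with exactly three nonzero coordinates. Let w ∈ ℝⁿ have every coordinate in {−1,1}. Then (1/m)·Σ_{i=1}^m (wᵀx_i + 1)² < 2/m if and only if wᵀx_i = −1 for every i = 1,…,m. -/
/-- The sum of a real family with entries in `{-1,0,1}` and exactly three nonzero entries
lies in `{-3,-1,1,3}`. -/
lemma sum_mem_of_card_ne_zero_eq_three {ι : Type*} [Fintype ι] (f : ι → ℝ)
    (hf : ∀ j, f j = -1 ∨ f j = 0 ∨ f j = 1)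
    (hcard : (Finset.univ.filter fun j => f j ≠ 0).card = 3) :
    ∑ j, f j = -3 ∨ ∑ j, f j = -1 ∨ ∑ j, f j = 1 ∨ ∑ j, f j = 3 := by
  classical
  obtain ⟨a, b, c, hab, hac, hbc, hs⟩ := Finset.card_eq_three.mp hcard
  have hunit : ∀ j ∈ ({a, b, c} : Finset ι), f j = -1 ∨ f j = 1 := by
    intro j hj
    rw [← hs, Finset.mem_filter] at hj
    have := hf j
    tauto
  have hsum : ∑ j, f j = f a + (f b + f c) := by
    rw [← Finset.sum_filter_ne_zero, hs, Finset.sum_insert (by simp [hab, hac]),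
      Finset.sum_pair hbc]
  rw [hsum]
  rcases hunit a (by simp) with ha | ha <;> rcases hunit b (by simp) with hb | hb <;>
    rcases hunit c (by simp) with hc | hc <;> rw [ha, hb, hc] <;> norm_num

/-- For clause vectors `x i ∈ {-1,0,1}ⁿ`, each with exactly three nonzero
coordinates, and a sign vector `w ∈ {-1,1}ⁿ`, the average square loss
`(1/m) ∑ i (wᵀxᵢ + 1)²` is below `2/m` iff `wᵀxᵢ = -1` for every `i`. -/
theorem avg_square_loss_lt_iff (n m : ℕ) (hn : 0 < n) (hm : 0 < m)
    (x : Fin m → Fin n → ℝ)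
    (hx : ∀ i : Fin m, ∀ j : Fin n, x i j = -1 ∨ x i j = 0 ∨ x i j = 1)
    (hx3 : ∀ i : Fin m, (Finset.univ.filter fun j : Fin n => x i j ≠ 0).card = 3)
    (w : Fin n → ℝ) (hw : ∀ j : Fin n, w j = -1 ∨ w j = 1) :
    (1 / m : ℝ) * ∑ i, ((∑ j, w j * x i j) + 1) ^ 2 < 2 / m ↔
      ∀ i : Fin m, (∑ j, w j * x i j) = -1 := by
  have hm' : (0 : ℝ) < m := by exact_mod_cast hm
  rw [one_div_mul_eq_div, div_lt_div_iff_of_pos_right hm']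
  constructor
  · intro h i
    have hi : ((∑ j, w j * x i j) + 1) ^ 2 < 2 :=
      (Finset.single_le_sum (f := fun i => ((∑ j, w j * x i j) + 1) ^ 2)
        (fun _ _ => sq_nonneg _) (Finset.mem_univ i)).trans_lt h
    have hprod : ∀ j, w j * x i j = -1 ∨ w j * x i j = 0 ∨ w j * x i j = 1 := by
      intro j
      rcases hw j with h1 | h1 <;> rcases hx i j with h2 | h2 | h2 <;> simp [h1, h2]
    have hcard : (Finset.univ.filter fun j => w j * x i j ≠ 0).card = 3 := by
      rw [← hx3 i]
      congr 1
      ext j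
      have hwj : w j ≠ 0 := by rcases hw j with h1 | h1 <;> simp [h1]
      simp [hwj]
    rcases sum_mem_of_card_ne_zero_eq_three _ hprod hcard with h1 | h1 | h1 | h1
    · rw [h1] at hi; norm_num at hi
    · exact h1
    · rw [h1] at hi; norm_num at hi
    · rw [h1] at hi; norm_num at hi
  · intro h
    simp [h]
end

section
/- Let n, m be positive integers, k ∈ {0,1,…,n}, and let x_1,…,x_m ∈ ℝⁿ each have every coordinate in {−1,0,1} with exactly three nonzero coordinates. Let w ∈ ℝⁿ be the vector whose first k coordinates equal 1 and whose remaining n−k coordinates equal −1. Then there exists a permutation π of {1,…,n} such that (1/m)·Σ_{i=1}^m |Σ_{j=1}^n w_{π(j)}·(x_i)_j + 1| < 2/m if and only if there exists a vector u ∈ {−1,1}ⁿ with exactly k coordinates equal to 1 such that for every i = 1,…,m, exactly one index j with (x_i)_j ≠ 0 satisfies u_j·(x_i)_j = 1. -/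
theorem Fin.card_filter_val_lt_of_le {n k : ℕ} (hk : k ≤ n) :
    (Finset.univ.filter fun j : Fin n => (j : ℕ) < k).card = k := by
  rw [Fin.card_filter_val_lt, min_eq_right hk]

/-- Two predicates on a finite type with equally many solutions differ by a permutation. -/
theorem exists_perm_forall_iff_of_card_filter_eq {α : Type*} [Fintype α] (p q : α → Prop)
    [DecidablePred p] [DecidablePred q]
    (h : (Finset.univ.filter p).card = (Finset.univ.filter q).card) :
    ∃ π : Equiv.Perm α, ∀ a, q (π a) ↔ p a := by
  have e : {a // p a} ≃ {a // q a} := Fintype.equivOfCardEq (by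
    rw [Fintype.card_subtype, Fintype.card_subtype, h])
  refine ⟨e.extendSubtype, fun a => ⟨fun ha => ?_, e.extendSubtype_mem a⟩⟩
  by_contra hpa
  exact e.extendSubtype_not_mem a hpa ha

/-- The inner product of a sign vector with a clause is the number of true literals minus the
number of false ones. -/
theorem sum_sign_mul_clause_eq {n : ℕ} {u y : Fin n → ℝ}
    (hu : ∀ j, u j = -1 ∨ u j = 1) (hy : ∀ j, y j = -1 ∨ y j = 0 ∨ y j = 1) :
    ∑ j, u j * y j = 2 * ((Finset.univ.filter fun j => y j ≠ 0 ∧ u j * y j = 1).card : ℝ)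
      - ((Finset.univ.filter fun j => y j ≠ 0).card : ℝ) := by
  rw [Finset.natCast_card_filter, Finset.natCast_card_filter, Finset.mul_sum,
    ← Finset.sum_sub_distrib]
  refine Finset.sum_congr rfl fun j _ => ?_
  rcases hu j with h | h <;> rcases hy j with h' | h' | h' <;> rw [h, h'] <;> norm_num

/-- For a 3-literal clause, the regression residual at label `-1` is twice the deviation of the
number of true literals from one. -/
theorem sum_sign_mul_clause_add_one {n : ℕ} {u y : Fin n → ℝ}
    (hu : ∀ j, u j = -1 ∨ u j = 1) (hy : ∀ j, y j = -1 ∨ y j = 0 ∨ y j = 1)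
    (hy3 : (Finset.univ.filter fun j => y j ≠ 0).card = 3) :
    (∑ j, u j * y j) + 1 =
      2 * (((Finset.univ.filter fun j => y j ≠ 0 ∧ u j * y j = 1).card : ℝ) - 1) := by
  rw [sum_sign_mul_clause_eq hu hy, hy3]
  push_cast
  ring

/-- The mean absolute loss of a sign vector on 3-literal clauses is less than `2 / m` iff every
clause has exactly one true literal. -/
theorem abs_loss_lt_iff_forall_existsUnique {n m : ℕ} (hm : 0 < m) {x : Fin m → Fin n → ℝ}
    (hx : ∀ i j, x i j = -1 ∨ x i j = 0 ∨ x i j = 1)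
    (hx3 : ∀ i, (Finset.univ.filter fun j => x i j ≠ 0).card = 3)
    {u : Fin n → ℝ} (hu : ∀ j, u j = -1 ∨ u j = 1) :
    (1 / m : ℝ) * ∑ i, |(∑ j, u j * x i j) + 1| < 2 / m ↔
      ∀ i, ∃! j, x i j ≠ 0 ∧ u j * x i j = 1 := by
  have hm' : (0 : ℝ) < m := Nat.cast_pos.mpr hm
  have card_eq_one_iff (i : Fin m) : (∃! j, x i j ≠ 0 ∧ u j * x i j = 1) ↔
      (Finset.univ.filter fun j => x i j ≠ 0 ∧ u j * x i j = 1).card = 1 := by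
    simp only [Finset.card_eq_one, Finset.singleton_iff_unique_mem, Finset.mem_filter_univ]
  rw [one_div_mul_eq_div, div_lt_div_iff_of_pos_right hm']
  simp only [card_eq_one_iff, sum_sign_mul_clause_add_one hu (hx _) (hx3 _)]
  constructor
  · intro h i
    have hi := (Finset.single_le_sum (f := fun i => |2 * (((Finset.univ.filter fun j =>
      x i j ≠ 0 ∧ u j * x i j = 1).card : ℝ) - 1)|) (fun i _ => abs_nonneg _)
      (Finset.mem_univ i)).trans_lt h
    obtain ⟨hlow, hhigh⟩ := abs_lt.mp hi
    have hpos : (0 : ℝ) < ((Finset.univ.filter fun j =>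
      x i j ≠ 0 ∧ u j * x i j = 1).card : ℝ) := by linarith
    have hlt : ((Finset.univ.filter fun j =>
      x i j ≠ 0 ∧ u j * x i j = 1).card : ℝ) < 2 := by linarith
    have hpos' := Nat.cast_pos.mp hpos
    have hlt' := Nat.cast_lt_ofNat.mp hlt
    omega
  · intro h
    simp [h]

/-- Correctness of the 1-IN-3SAT reduction for the absolute-value regression loss:
there is a permutation `π` making the test loss `(1/m) ∑ i |w_πᵀxᵢ + 1|` less than `2/m` iff
there is a sign vector `u ∈ {-1,1}ⁿ` with exactly `k` coordinates equal to `1` such that every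
clause `xᵢ` has exactly one true literal under `u`. -/
theorem exists_perm_abs_loss_lt_iff_one_in_three_sat (n m : ℕ) (hn : 0 < n) (hm : 0 < m)
    (k : ℕ) (hk : k ≤ n)
    (x : Fin m → Fin n → ℝ)
    (hx : ∀ i : Fin m, ∀ j : Fin n, x i j = -1 ∨ x i j = 0 ∨ x i j = 1)
    (hx3 : ∀ i : Fin m, (Finset.univ.filter fun j : Fin n => x i j ≠ 0).card = 3)
    (w : Fin n → ℝ) (hw : ∀ i : Fin n, w i = if (i : ℕ) < k then 1 else -1) :
    (∃ π : Equiv.Perm (Fin n),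
        (1 / m : ℝ) * ∑ i, |(∑ j, w (π j) * x i j) + 1| < 2 / m) ↔
      (∃ u : Fin n → ℝ, (∀ j : Fin n, u j = -1 ∨ u j = 1) ∧
        (Finset.univ.filter fun j : Fin n => u j = 1).card = k ∧
        ∀ i : Fin m, ∃! j : Fin n, x i j ≠ 0 ∧ u j * x i j = 1) := by
  have hw1 (i : Fin n) : w i = 1 ↔ (i : ℕ) < k := by
    rw [hw]
    split_ifs with h <;> norm_num [h]
  have hw_sign (i : Fin n) : w i = -1 ∨ w i = 1 := by
    rw [hw]
    split_ifs <;> simp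
  constructor
  · rintro ⟨π, hπ⟩
    refine ⟨fun j => w (π j), fun j => hw_sign _, ?_,
      (abs_loss_lt_iff_forall_existsUnique hm hx hx3 fun j => hw_sign (π j)).mp hπ⟩
    simp only [hw1]
    rw [← Fin.card_filter_val_lt_of_le hk]
    exact Finset.card_equiv π (by simp [Fin.card_filter_val_lt_of_le hk])
  · rintro ⟨u, hu, hcard, hsat⟩
    obtain ⟨π, hπ⟩ := exists_perm_forall_iff_of_card_filter_eq (fun j => u j = 1)
      (fun j : Fin n => (j : ℕ) < k) (hcard.trans (Fin.card_filter_val_lt_of_le hk).symm)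
    have hwu (j : Fin n) : w (π j) = u j := by
      rcases hu j with h | h
      · rw [hw, if_neg (by rw [hπ, h]; norm_num), h]
      · rw [hw, if_pos ((hπ j).mpr h), h]
    refine ⟨π, ?_⟩
    simp only [hwu]
    exact (abs_loss_lt_iff_forall_existsUnique hm hx hx3 hu).mpr hsat
end

section
/- Let n, m be positive integers and for each i = 1,…,m let (a_i, b_i, c_i) be an ordered triple of pairwise distinct indices in {1,…,n}. Let w = (1,2,…,n) ∈ ℝⁿ and for each i let x_{i,1}, x_{i,2}, x_{i,3} ∈ ℝⁿ be the vectors that are zero except: x_{i,1} is −1 at a_i and 1 at b_i; x_{i,2} is −1 at b_i and 1 at c_i; x_{i,3} is −1 at c_i and 1 at a_i. Then for every permutation π of {1,…,n}, (1/(3m))·Σ_{i=1}^m Σ_{j=1}^3 𝟙[w_πᵀx_{i,j} ≤ 0] = (m + V(π))/(3m), where V(π) is the number of indices i ∈ {1,…,m} such that π satisfies none of the three conditions (I) π(a_i) < π(b_i) < π(c_i), (II) π(b_i) < π(c_i) < π(a_i), (III) π(c_i) < π(a_i) < π(b_i). In particular the left-hand side is always at least 1/3, and equals 1/3 if and only if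 π satisfies one of (I)–(III) for every i. -/
theorem sum_mul_ite_neg_one_one {ι R : Type*} [Fintype ι] [DecidableEq ι] [Ring R]
    (f : ι → R) {p q : ι} (hpq : p ≠ q) :
    ∑ l, f l * (if l = p then -1 else if l = q then 1 else 0) = f q - f p := by
  have h : ∀ l, f l * (if l = p then -1 else if l = q then 1 else 0) =
      (if l = q then f l else 0) - (if l = p then f l else 0) := by
    intro l
    by_cases h1 : l = p
    · subst h1
      simp [hpq]
    · simp [h1]
  simp [h, Finset.sum_sub_distrib]

/-- Around a cycle of three distinct elements of a linear order there is one descent if the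
cycle is positively oriented, and two otherwise. -/
theorem cyclic_descents_eq {α R : Type*} [LinearOrder α] [Semiring R] {p q r : α}
    (hpq : p ≠ q) (hqr : q ≠ r) (hrp : r ≠ p) :
    (if q ≤ p then (1 : R) else 0) + (if r ≤ q then 1 else 0) + (if p ≤ r then 1 else 0) =
      1 + if ¬ ((p < q ∧ q < r) ∨ (q < r ∧ r < p) ∨ (r < p ∧ p < q)) then 1 else 0 := by
  rcases lt_or_gt_of_ne hpq with h1 | h1 <;> rcases lt_or_gt_of_ne hqr with h2 | h2 <;>
    rcases lt_or_gt_of_ne hrp with h3 | h3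
  · exact absurd (h1.trans (h2.trans h3)) (lt_irrefl _)
  all_goals first
    | exact absurd (h3.trans (h2.trans h1)) (lt_irrefl _)
    | simp [h1, h2, h3, h1.le, h2.le, h3.le, h1.not_ge, h2.not_ge, h3.not_ge,
        h1.not_gt, h2.not_gt, h3.not_gt]


/-- For `w = (1,2,…,n)`, the CYCLIC-ORDERING clause vectors `x i j`, and any
permutation `π`, the average binary classification loss
`(1/(3m)) ∑ i ∑ j 𝟙[w_πᵀx_{i,j} ≤ 0]` equals `(m + V(π))/(3m)`, where `V(π)` counts the triples
`(aᵢ, bᵢ, cᵢ)` for which `π` satisfies none of the three cyclic ordering conditions; in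
particular the loss is at least `1/3`, with equality iff every triple satisfies one of them. -/
theorem binary_loss_eq_violation_count (n m : ℕ) (hn : 0 < n) (hm : 0 < m)
    (a b c : Fin m → Fin n)
    (habc : ∀ i : Fin m, a i ≠ b i ∧ b i ≠ c i ∧ c i ≠ a i)
    (w : Fin n → ℝ) (hw : ∀ j : Fin n, w j = (j : ℕ) + 1)
    (x : Fin m → Fin 3 → Fin n → ℝ)
    (hx1 : ∀ i : Fin m, ∀ l : Fin n,
      x i 0 l = if l = a i then -1 else if l = b i then 1 else 0)
    (hx2 : ∀ i : Fin m, ∀ l : Fin n,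
      x i 1 l = if l = b i then -1 else if l = c i then 1 else 0)
    (hx3 : ∀ i : Fin m, ∀ l : Fin n,
      x i 2 l = if l = c i then -1 else if l = a i then 1 else 0)
    (π : Equiv.Perm (Fin n)) :
    ((1 / (3 * m) : ℝ) * ∑ i, ∑ j : Fin 3,
        (if (∑ l, w (π l) * x i j l) ≤ 0 then (1 : ℝ) else 0) =
      ((m : ℝ) + (Finset.univ.filter fun i : Fin m =>
        ¬ ((π (a i) < π (b i) ∧ π (b i) < π (c i)) ∨
            (π (b i) < π (c i) ∧ π (c i) < π (a i)) ∨
            (π (c i) < π (a i) ∧ π (a i) < π (b i)))).card) / (3 * m)) ∧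
    ((1 / 3 : ℝ) ≤ (1 / (3 * m) : ℝ) * ∑ i, ∑ j : Fin 3,
        (if (∑ l, w (π l) * x i j l) ≤ 0 then (1 : ℝ) else 0)) ∧
    ((1 / (3 * m) : ℝ) * ∑ i, ∑ j : Fin 3,
        (if (∑ l, w (π l) * x i j l) ≤ 0 then (1 : ℝ) else 0) = 1 / 3 ↔
      ∀ i : Fin m,
        (π (a i) < π (b i) ∧ π (b i) < π (c i)) ∨
        (π (b i) < π (c i) ∧ π (c i) < π (a i)) ∨
        (π (c i) < π (a i) ∧ π (a i) < π (b i))) := by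
  have hdiff : ∀ p q : Fin n, w (π q) - w (π p) ≤ 0 ↔ π q ≤ π p := by
    intro p q
    rw [sub_nonpos, hw, hw, add_le_add_iff_right, Nat.cast_le, Fin.le_def]
  have hrow : ∀ i : Fin m, ∑ j : Fin 3,
      (if (∑ l, w (π l) * x i j l) ≤ 0 then (1 : ℝ) else 0) =
        1 + if ¬ ((π (a i) < π (b i) ∧ π (b i) < π (c i)) ∨
          (π (b i) < π (c i) ∧ π (c i) < π (a i)) ∨
          (π (c i) < π (a i) ∧ π (a i) < π (b i))) then 1 else 0 := by
    intro i
    obtain ⟨hab, hbc, hca⟩ := habc i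
    rw [← cyclic_descents_eq (π.injective.ne hab) (π.injective.ne hbc) (π.injective.ne hca),
      Fin.sum_univ_three]
    simp only [hx1, hx2, hx3]
    rw [sum_mul_ite_neg_one_one (fun l => w (π l)) hab,
      sum_mul_ite_neg_one_one (fun l => w (π l)) hbc,
      sum_mul_ite_neg_one_one (fun l => w (π l)) hca]
    simp only [hdiff]
  have hm' : (0 : ℝ) < m := by exact_mod_cast hm
  simp only [hrow, Finset.sum_add_distrib, Finset.sum_boole, Finset.sum_const,
    Finset.card_univ, Fintype.card_fin, nsmul_eq_mul, mul_one]
  refine ⟨by rw [one_div_mul_eq_div], ?_, ?_⟩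
  · rw [one_div_mul_eq_div, div_le_div_iff₀ (by norm_num) (by positivity)]
    linarith [Nat.cast_nonneg (α := ℝ) (Finset.univ.filter fun i : Fin m =>
        ¬ ((π (a i) < π (b i) ∧ π (b i) < π (c i)) ∨
            (π (b i) < π (c i) ∧ π (c i) < π (a i)) ∨
            (π (c i) < π (a i) ∧ π (a i) < π (b i)))).card]
  · rw [one_div_mul_eq_div, div_eq_div_iff (by positivity) (by norm_num), one_mul, mul_comm,
      mul_right_inj' (by norm_num), add_eq_left, Nat.cast_eq_zero, Finset.card_eq_zero,
      Finset.filter_eq_empty_iff]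
    simp only [Finset.mem_univ, true_implies, not_not]
end

section
/- Let n, m be positive integers and for each i = 1,…,m let (a_i, b_i, c_i) be an ordered triple of pairwise distinct indices in {1,…,n}. Let w = (1,2,…,n) ∈ ℝⁿ and define the vectors x_{i,j} ∈ ℝⁿ for j = 1,2,3 as: zero except x_{i,1} is −1 at a_i and 1 at b_i; x_{i,2} is −1 at b_i and 1 at c_i; x_{i,3} is −1 at c_i and 1 at a_i. Then there exists a permutation π of {1,…,n} with (1/(3m))·Σ_{i=1}^m Σ_{j=1}^3 𝟙[w_πᵀx_{i,j} ≤ 0] < (m+1)/(3m) if and only if there exists a permutation π of {1,…,n} such that for every i = 1,…,m one of the three conditions (I) π(a_i) < π(b_i) < π(c_i), (II) π(b_i) < π(c_i) < π(a_i), (III) π(c_i) < π(a_i) < π(b_i) holds. -/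
/-- Pairing a vector with the difference of two coordinate indicators. -/
lemma sum_mul_ite_neg_one_ite_one {ι R : Type*} [Fintype ι] [DecidableEq ι] [Ring R] (v : ι → R)
    {p q : ι} (hpq : p ≠ q) :
    ∑ l, v l * (if l = p then -1 else if l = q then 1 else 0) = v q - v p := by
  have h : ∀ l, v l * (if l = p then -1 else if l = q then 1 else 0) =
      (if l = q then v l else 0) - (if l = p then v l else 0) := by
    intro l
    split_ifs <;> simp_all
  simp [h, Finset.sum_sub_distrib]

/-- For three distinct elements of a linear order, the number of cyclically consecutive descents
is one if they are in cyclic order and two otherwise. -/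
lemma sum_descents_eq_one_add_ite {α : Type*} [LinearOrder α] {p q r : α}
    (hpq : p ≠ q) (hqr : q ≠ r) (hrp : r ≠ p) :
    (if q ≤ p then (1 : ℝ) else 0) + (if r ≤ q then 1 else 0) + (if p ≤ r then 1 else 0) =
      1 + if (p < q ∧ q < r) ∨ (q < r ∧ r < p) ∨ (r < p ∧ p < q) then 0 else 1 := by
  rcases hpq.lt_or_gt with h | h <;> rcases hqr.lt_or_gt with h' | h' <;>
    rcases hrp.lt_or_gt with h'' | h'' <;>
    first
    | exact absurd (h.trans h') h''.not_gt
    | exact absurd (h'.trans h) h''.not_gt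
    | norm_num [h.le, h.not_ge, h.not_gt, h, h'.le, h'.not_ge, h'.not_gt, h', h''.le, h''.not_ge,
        h''.not_gt, h'']

/-- A sum over `ι` of terms equal to one or two is below `card ι + 1` iff every term is one. -/
lemma sum_one_add_ite_lt_iff {ι : Type*} [Fintype ι] (P : ι → Prop) [DecidablePred P] :
    ∑ i, (1 + if P i then (0 : ℝ) else 1) < Fintype.card ι + 1 ↔ ∀ i, P i := by
  have h : ∑ i, (if P i then (0 : ℝ) else 1) = (Finset.univ.filter fun i => ¬ P i).card := by
    simp [← Finset.sum_boole, ite_not]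
  rw [Finset.sum_add_distrib, h]
  simp [Finset.filter_eq_empty_iff]

/-- Correctness of the CYCLIC-ORDERING reduction for the binary classification
loss: there exists a permutation `π` with average loss
`(1/(3m)) ∑ i ∑ j 𝟙[w_πᵀx_{i,j} ≤ 0]` below `(m+1)/(3m)` iff there exists a permutation `π`
satisfying, for every `i`, one of the three cyclic ordering conditions for `(aᵢ, bᵢ, cᵢ)`. -/
theorem exists_perm_binary_loss_lt_iff_cyclic_ordering (n m : ℕ) (hn : 0 < n) (hm : 0 < m)
    (a b c : Fin m → Fin n)
    (habc : ∀ i : Fin m, a i ≠ b i ∧ b i ≠ c i ∧ c i ≠ a i)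
    (w : Fin n → ℝ) (hw : ∀ j : Fin n, w j = (j : ℕ) + 1)
    (x : Fin m → Fin 3 → Fin n → ℝ)
    (hx1 : ∀ i : Fin m, ∀ l : Fin n,
      x i 0 l = if l = a i then -1 else if l = b i then 1 else 0)
    (hx2 : ∀ i : Fin m, ∀ l : Fin n,
      x i 1 l = if l = b i then -1 else if l = c i then 1 else 0)
    (hx3 : ∀ i : Fin m, ∀ l : Fin n,
      x i 2 l = if l = c i then -1 else if l = a i then 1 else 0) :
    (∃ π : Equiv.Perm (Fin n),
        (1 / (3 * m) : ℝ) * ∑ i, ∑ j : Fin 3,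
          (if (∑ l, w (π l) * x i j l) ≤ 0 then (1 : ℝ) else 0) < ((m : ℝ) + 1) / (3 * m)) ↔
      (∃ π : Equiv.Perm (Fin n), ∀ i : Fin m,
        (π (a i) < π (b i) ∧ π (b i) < π (c i)) ∨
        (π (b i) < π (c i) ∧ π (c i) < π (a i)) ∨
        (π (c i) < π (a i) ∧ π (a i) < π (b i))) := by
  have hm' : (0 : ℝ) < 3 * m := by positivity
  have key : ∀ (π : Equiv.Perm (Fin n)) {p q : Fin n}, p ≠ q →
      ((∑ l, w (π l) * (if l = p then -1 else if l = q then 1 else 0) ≤ 0) ↔ π q ≤ π p) := by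
    intro π p q hpq
    rw [sum_mul_ite_neg_one_ite_one (fun l => w (π l)) hpq]
    simp [hw]
  refine exists_congr fun π => ?_
  rw [one_div_mul_eq_div, div_lt_div_iff_of_pos_right hm']
  have hsum : ∀ i, (∑ j : Fin 3, if (∑ l, w (π l) * x i j l) ≤ 0 then (1 : ℝ) else 0) =
      1 + if (π (a i) < π (b i) ∧ π (b i) < π (c i)) ∨ (π (b i) < π (c i) ∧ π (c i) < π (a i)) ∨
        (π (c i) < π (a i) ∧ π (a i) < π (b i)) then 0 else 1 := by
    intro i
    obtain ⟨hab, hbc, hca⟩ := habc i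
    simp only [Fin.sum_univ_three, hx1, hx2, hx3, key π hab, key π hbc, key π hca]
    exact sum_descents_eq_one_add_ite (π.injective.ne hab) (π.injective.ne hbc)
      (π.injective.ne hca)
  simp only [hsum]
  simpa only [Fintype.card_fin] using sum_one_add_ite_lt_iff (fun i : Fin m =>
    (π (a i) < π (b i) ∧ π (b i) < π (c i)) ∨ (π (b i) < π (c i) ∧ π (c i) < π (a i)) ∨
      (π (c i) < π (a i) ∧ π (a i) < π (b i)))
end

section
/- Let n, m be positive integers, ε ∈ (0, 1/2), and z = ln((1−ε)/ε). For each i = 1,…,m let (a_i, b_i, c_i) be an ordered triple of pairwise distinct indices in {1,…,n}, and define x_{i,j} ∈ ℝⁿ for j = 1,2,3 as: zero except x_{i,1} is −z at a_i and z at b_i; x_{i,2} is −z at b_i and z at c_i; x_{i,3} is −z at c_i and z at a_i. Let w = (1,2,…,n). If a permutation π of {1,…,n} is such that for every i one of the conditions (I) π(a_i) < π(b_i) < π(c_i), (II) π(b_i) < π(c_i) < π(a_i), (III) π(c_i) < π(a_i) < π(b_i) holds, then (1/(3m))·Σ_{i=1}^m Σ_{j=1}^3 1/(1 + exp(w_πᵀx_{i,j}))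 ≤ (1 + 2ε)/3. -/
theorem sum_mul_ite_neg_ite {ι : Type*} [Fintype ι] [DecidableEq ι] (v : ι → ℝ) (z : ℝ)
    {p q : ι} (hpq : p ≠ q) :
    ∑ l, v l * (if l = p then -z else if l = q then z else 0) = z * (v q - v p) := by
  have h : ∀ l, v l * (if l = p then -z else if l = q then z else 0) =
      (if l = q then v l * z else 0) - (if l = p then v l * z else 0) := by
    intro l
    by_cases hp : l = p
    · subst hp
      simp [hpq]
    · simp [hp]
  simp only [h, Finset.sum_sub_distrib, Finset.sum_ite_eq', Finset.mem_univ, if_true]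
  ring

theorem one_div_one_add_exp_le_one (t : ℝ) : 1 / (1 + Real.exp t) ≤ 1 := by
  rw [div_le_one (by positivity)]
  linarith [Real.exp_pos t]

theorem one_div_one_add_exp_le_of_log_le {ε t : ℝ} (h0 : 0 < ε) (h1 : ε < 1)
    (ht : Real.log ((1 - ε) / ε) ≤ t) : 1 / (1 + Real.exp t) ≤ ε := by
  have hexp : (1 - ε) / ε ≤ Real.exp t :=
    (Real.log_le_iff_le_exp (div_pos (by linarith) h0)).1 ht
  rw [div_le_iff₀ h0] at hexp
  rw [div_le_iff₀ (by positivity)]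
  linarith

theorem log_one_sub_div_self_nonneg {ε : ℝ} (h0 : 0 < ε) (h1 : ε ≤ 1 / 2) :
    0 ≤ Real.log ((1 - ε) / ε) :=
  Real.log_nonneg ((one_le_div h0).2 (by linarith))

/-- With `ε ∈ (0, 1/2)`, `z = ln((1-ε)/ε)`, `w = (1,2,…,n)`, and the
CYCLIC-ORDERING clause vectors `x i j` built from `z`: if a permutation `π` satisfies, for every
`i`, one of the three cyclic ordering conditions for `(aᵢ, bᵢ, cᵢ)`, then the average logistic
loss `(1/(3m)) ∑ i ∑ j 1/(1 + exp(w_πᵀx_{i,j}))` is at most `(1 + 2ε)/3`. -/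
theorem logistic_loss_le_of_cyclic_ordering (n m : ℕ) (hn : 0 < n) (hm : 0 < m)
    (ε : ℝ) (hε : ε ∈ Set.Ioo (0 : ℝ) (1 / 2)) (z : ℝ) (hz : z = Real.log ((1 - ε) / ε))
    (a b c : Fin m → Fin n)
    (habc : ∀ i : Fin m, a i ≠ b i ∧ b i ≠ c i ∧ c i ≠ a i)
    (w : Fin n → ℝ) (hw : ∀ j : Fin n, w j = (j : ℕ) + 1)
    (x : Fin m → Fin 3 → Fin n → ℝ)
    (hx1 : ∀ i : Fin m, ∀ l : Fin n,
      x i 0 l = if l = a i then -z else if l = b i then z else 0)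
    (hx2 : ∀ i : Fin m, ∀ l : Fin n,
      x i 1 l = if l = b i then -z else if l = c i then z else 0)
    (hx3 : ∀ i : Fin m, ∀ l : Fin n,
      x i 2 l = if l = c i then -z else if l = a i then z else 0)
    (π : Equiv.Perm (Fin n))
    (hπ : ∀ i : Fin m,
      (π (a i) < π (b i) ∧ π (b i) < π (c i)) ∨
      (π (b i) < π (c i) ∧ π (c i) < π (a i)) ∨
      (π (c i) < π (a i) ∧ π (a i) < π (b i))) :
    (1 / (3 * m) : ℝ) * ∑ i, ∑ j : Fin 3,
        1 / (1 + Real.exp (∑ l, w (π l) * x i j l)) ≤ (1 + 2 * ε) / 3 := by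
  obtain ⟨h0, h1⟩ := hε
  have hz0 : 0 ≤ z := hz ▸ log_one_sub_div_self_nonneg h0 h1.le
  have hloss : ∀ p q : Fin n, p < q → 1 / (1 + Real.exp (z * (w q - w p))) ≤ ε := by
    intro p q hpq
    have hgap : (p : ℝ) + 1 ≤ (q : ℝ) := by exact_mod_cast hpq
    refine one_div_one_add_exp_le_of_log_le h0 (by linarith) ?_
    rw [← hz, hw, hw]
    exact le_mul_of_one_le_right hz0 (by linarith)
  have htriple : ∀ i, ∑ j : Fin 3, 1 / (1 + Real.exp (∑ l, w (π l) * x i j l)) ≤ 1 + 2 * ε := by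
    intro i
    obtain ⟨hab, hbc, hca⟩ := habc i
    simp only [Fin.sum_univ_three, hx1, hx2, hx3,
      sum_mul_ite_neg_ite (fun l => w (π l)) z hab,
      sum_mul_ite_neg_ite (fun l => w (π l)) z hbc,
      sum_mul_ite_neg_ite (fun l => w (π l)) z hca]
    have hab_le := one_div_one_add_exp_le_one (z * (w (π (b i)) - w (π (a i))))
    have hbc_le := one_div_one_add_exp_le_one (z * (w (π (c i)) - w (π (b i))))
    have hca_le := one_div_one_add_exp_le_one (z * (w (π (a i)) - w (π (c i))))
    rcases hπ i with ⟨h, h'⟩ | ⟨h, h'⟩ | ⟨h, h'⟩ <;>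
      linarith [hloss _ _ h, hloss _ _ h']
  have hm' : (0 : ℝ) < m := by exact_mod_cast hm
  calc (1 / (3 * m) : ℝ) * ∑ i, ∑ j : Fin 3, 1 / (1 + Real.exp (∑ l, w (π l) * x i j l))
      ≤ 1 / (3 * m) * ∑ _i : Fin m, (1 + 2 * ε) := by
        gcongr with i
        exact htriple i
    _ = (1 + 2 * ε) / 3 := by
        simp only [Finset.sum_const, Finset.card_univ, Fintype.card_fin, nsmul_eq_mul]
        field_simp
end
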